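/- Let u : ℝ₊ × ℝ^{2d+1} → ℝ^{2d} and p : ℝ₊ × ℝ^{2d+1} → ℝ be smooth, with u(t,·), p(t,·) Schwartz in space locally uniformly in t, solving the sub-Riemannian Navier–Stokes system ∂_t u − Δ_ℍ u + u·∇_ℍ u = −∇_ℍ p and div_ℍ(u) = 0. Then the kinetic energy dissipates according to (1/2)(d/dt)‖u(t)‖²_{L²} + ‖∇_ℍ u(t)‖²_{L²} = 0 for all t > 0, where ‖∇_ℍ u‖²_{L²} = ∑_{i=1}^{2d}∑_{j=1}^{2d} ‖P_j u_i‖²_{L²}. -/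

import Mathlib

open MeasureTheory

/-- Points of the Heisenberg group `ℍ^d`, written `(y, η, s)`. -/
abbrev HPt (d : ℕ) := (Fin d → ℝ) × (Fin d → ℝ) × ℝ

/-- Coordinate direction `∂_{y_j}`. -/
def ey (d : ℕ) (j : Fin d) : HPt d := (Pi.single j 1, 0, 0)

/-- Coordinate direction `∂_{η_j}`. -/
def eEta (d : ℕ) (j : Fin d) : HPt d := (0, Pi.single j 1, 0)

/-- Coordinate direction `∂_s`. -/
def es (d : ℕ) : HPt d := (0, 0, 1)

/-- The left-invariant field `X_j = ∂_{y_j} + 2η_j ∂_s`. -/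
noncomputable def Xop (d : ℕ) (j : Fin d) (f : HPt d → ℝ) : HPt d → ℝ :=
  fun p => fderiv ℝ f p (ey d j) + 2 * p.2.1 j * fderiv ℝ f p (es d)

/-- The left-invariant field `Ξ_j = ∂_{η_j} − 2y_j ∂_s`. -/
noncomputable def Xiop (d : ℕ) (j : Fin d) (f : HPt d → ℝ) : HPt d → ℝ :=
  fun p => fderiv ℝ f p (eEta d j) - 2 * p.1 j * fderiv ℝ f p (es d)

/-- The right-invariant field `X̃_j = ∂_{y_j} − 2η_j ∂_s`. -/
noncomputable def Xtop (d : ℕ) (j : Fin d) (f : HPt d → ℝ) : HPt d → ℝ :=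
  fun p => fderiv ℝ f p (ey d j) - 2 * p.2.1 j * fderiv ℝ f p (es d)

/-- The right-invariant field `Ξ̃_j = ∂_{η_j} + 2y_j ∂_s`. -/
noncomputable def Xitop (d : ℕ) (j : Fin d) (f : HPt d → ℝ) : HPt d → ℝ :=
  fun p => fderiv ℝ f p (eEta d j) + 2 * p.1 j * fderiv ℝ f p (es d)

/-- The horizontal fields `P_j`: `P_j = X_j` for the first `d` indices and `P_{j+d} = Ξ_j`
for the last `d` indices. -/
noncomputable def Pop (d : ℕ) : Fin d ⊕ Fin d → (HPt d → ℝ) → HPt d → ℝ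
  | Sum.inl j => Xop d j
  | Sum.inr j => Xiop d j

open LineDeriv
open scoped SchwartzMap Topology

section Schwartz

variable {E : Type*} [NormedAddCommGroup E] [NormedSpace ℝ E]

/-- The pointwise product of two real Schwartz functions. -/
noncomputable def SchwartzMap.mulPair (f g : 𝓢(E, ℝ)) : 𝓢(E, ℝ) :=
  SchwartzMap.pairing (ContinuousLinearMap.mul ℝ ℝ) f g

theorem SchwartzMap.mulPair_apply (f g : 𝓢(E, ℝ)) (x : E) : f.mulPair g x = f x * g x := rfl

/-- A continuous curve of Schwartz functions decays uniformly over compact sets of times. -/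
theorem SchwartzMap.exists_forall_one_add_norm_pow_mul_le {F : ℝ → 𝓢(E, ℝ)} (hF : Continuous F)
    {K : Set ℝ} (hK : IsCompact K) (k : ℕ) :
    ∃ C, 0 ≤ C ∧ ∀ t ∈ K, ∀ x, (1 + ‖x‖) ^ k * |F t x| ≤ C := by
  have hc : ∀ m : ℕ, Continuous fun t => SchwartzMap.seminorm ℝ m 0 (F t) := fun m =>
    ((schwartz_withSeminorms ℝ E ℝ).continuous_seminorm (m, 0)).comp hF
  have hcont : Continuous fun t => (2 : ℝ) ^ (k - 1) *
      (SchwartzMap.seminorm ℝ 0 0 (F t) + SchwartzMap.seminorm ℝ k 0 (F t)) :=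
    continuous_const.mul ((hc 0).add (hc k))
  obtain ⟨C, hC⟩ := hK.bddAbove_image hcont.continuousOn
  refine ⟨max C 0, le_max_right _ _, fun t ht x => le_trans ?_ (le_max_left _ _)⟩
  refine le_trans ?_ (hC (Set.mem_image_of_mem _ ht))
  show _ ≤ (2 : ℝ) ^ (k - 1) *
    (SchwartzMap.seminorm ℝ 0 0 (F t) + SchwartzMap.seminorm ℝ k 0 (F t))
  have h0 : |F t x| ≤ SchwartzMap.seminorm ℝ 0 0 (F t) := norm_le_seminorm ℝ (F t) x
  have h1 : ‖x‖ ^ k * |F t x| ≤ SchwartzMap.seminorm ℝ k 0 (F t) :=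
    norm_pow_mul_le_seminorm ℝ (F t) k x
  have h2 : (1 + ‖x‖) ^ k ≤ 2 ^ (k - 1) * (1 ^ k + ‖x‖ ^ k) :=
    add_pow_le zero_le_one (norm_nonneg x) k
  calc (1 + ‖x‖) ^ k * |F t x| ≤ 2 ^ (k - 1) * (1 ^ k + ‖x‖ ^ k) * |F t x| := by gcongr
    _ = 2 ^ (k - 1) * (|F t x| + ‖x‖ ^ k * |F t x|) := by ring
    _ ≤ _ := by gcongr

theorem SchwartzMap.exists_forall_abs_le {F : ℝ → 𝓢(E, ℝ)} (hF : Continuous F)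
    {K : Set ℝ} (hK : IsCompact K) : ∃ C, 0 ≤ C ∧ ∀ t ∈ K, ∀ x, |F t x| ≤ C := by
  simpa using SchwartzMap.exists_forall_one_add_norm_pow_mul_le hF hK 0

variable [FiniteDimensional ℝ E] [MeasurableSpace E] [BorelSpace E]
  (μ : Measure E) [μ.IsAddHaarMeasure]

theorem SchwartzMap.integral_lineDerivOp (f : 𝓢(E, ℝ)) (v : E) : ∫ x, ∂_{v} f x ∂μ = 0 := by
  have h := integral_bilinear_hasLineDerivAt_right_eq_neg_left_of_integrable (μ := μ)
    (f := fun _ : E => (1 : ℝ)) (f' := fun _ => (0 : ℝ)) (g := f) (g' := fun x => ∂_{v} f x) (v := v)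
    (B := ContinuousLinearMap.mul ℝ ℝ)
    (by simp) (by simpa using! (∂_{v} f).integrable) (by simpa using f.integrable)
    (fun x _ => (hasFDerivAt_const (1 : ℝ) x).hasLineDerivAt v)
    (fun x _ => (f.hasFDerivAt x).hasLineDerivAt v)
  simpa using h

/-- Differentiation under the integral sign for the `L²` energy of a curve of Schwartz functions
whose time derivative is locally bounded. -/
theorem SchwartzMap.hasDerivAt_integral_sum_sq {ι : Type*} [Fintype ι]
    {u w : ℝ → ι → 𝓢(E, ℝ)} (hu : ∀ i, Continuous fun t => u t i) {K : Set ℝ} {t : ℝ}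
    (hK : IsCompact K) (hKt : K ∈ 𝓝 t)
    (hw : ∀ i, ∃ C, ∀ τ ∈ K, ∀ x, |w τ i x| ≤ C)
    (hderiv : ∀ τ ∈ K, ∀ i x, HasDerivAt (fun r => u r i x) (w τ i x) τ) :
    HasDerivAt (fun τ => ∫ x, ∑ i, (u τ i x) ^ 2 ∂μ) (∫ x, ∑ i, 2 * (u t i x * w t i x) ∂μ) t := by
  choose D hD using hw
  choose C hC0 hC using fun i =>
    exists_forall_one_add_norm_pow_mul_le (hu i) hK μ.integrablePower
  have hsq : ∀ τ, (fun x => ∑ i, (u τ i x) ^ 2) = ∑ i, ⇑((u τ i).mulPair (u τ i)) := by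
    intro τ
    ext x
    simp [mulPair_apply, sq]
  refine (hasDerivAt_integral_of_dominated_loc_of_deriv_le (s := K)
    (F := fun τ x => ∑ i, (u τ i x) ^ 2) (F' := fun τ x => ∑ i, 2 * (u τ i x * w τ i x))
    (bound := fun x => ∑ i, 2 * (C i * D i) * (1 + ‖x‖) ^ (-(μ.integrablePower : ℝ)))
    hKt ?_ ?_ ?_ ?_ ?_ ?_).2
  · refine .of_forall fun τ => Continuous.aestronglyMeasurable ?_
    have := fun i => (u τ i).continuous
    fun_prop
  · exact integrable_finsetSum _ fun i _ => by
      simpa only [mulPair_apply, sq] using! ((u t i).mulPair (u t i)).integrable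
  · refine Continuous.aestronglyMeasurable ?_
    have := fun i => (u t i).continuous
    have := fun i => (w t i).continuous
    fun_prop
  · refine .of_forall fun x τ hτ => (norm_sum_le _ _).trans (Finset.sum_le_sum fun i _ => ?_)
    have hpos : 0 < (1 + ‖x‖) ^ μ.integrablePower := by positivity
    have h1 : |u τ i x| ≤ C i * (1 + ‖x‖) ^ (-(μ.integrablePower : ℝ)) := by
      rw [Real.rpow_neg (by positivity), Real.rpow_natCast, ← div_eq_mul_inv, le_div_iff₀ hpos,
        mul_comm]
      exact hC i τ hτ x
    have h2 := hD i τ hτ x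
    rw [Real.norm_eq_abs, abs_mul, abs_mul, abs_two]
    calc 2 * (|u τ i x| * |w τ i x|)
        ≤ 2 * ((C i * (1 + ‖x‖) ^ (-(μ.integrablePower : ℝ))) * D i) := by
          gcongr
          exact mul_nonneg (hC0 i) (by positivity)
      _ = _ := by ring
  · exact integrable_finsetSum _ fun i _ =>
      (Measure.integrable_pow_neg_integrablePower μ).const_mul _
  · refine .of_forall fun x τ hτ => HasDerivAt.fun_sum fun i _ => ?_
    convert! (hderiv τ hτ i x).pow 2 using 1
    simp [mul_assoc]

end Schwartz

section Horizontal

variable {d : ℕ}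

instance : (volume : Measure (HPt d)).IsAddHaarMeasure :=
  haveI : (volume : Measure ((Fin d → ℝ) × ℝ)).IsAddHaarMeasure :=
    Measure.prod.instIsAddHaarMeasure (volume : Measure (Fin d → ℝ)) (volume : Measure ℝ)
  Measure.prod.instIsAddHaarMeasure (volume : Measure (Fin d → ℝ))
    (volume : Measure ((Fin d → ℝ) × ℝ))

/-- The constant-coefficient part of the horizontal field `P_k`. -/
def horizontalDir (d : ℕ) : Fin d ⊕ Fin d → HPt d
  | Sum.inl j => ey d j
  | Sum.inr j => eEta d j

/-- The linear coefficient of `∂_s` in the horizontal field `P_k`. -/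
noncomputable def verticalCoeff (d : ℕ) : Fin d ⊕ Fin d → HPt d →L[ℝ] ℝ
  | Sum.inl j => (2 : ℝ) • (ContinuousLinearMap.proj j ∘L
      ContinuousLinearMap.fst ℝ (Fin d → ℝ) ℝ ∘L ContinuousLinearMap.snd ℝ (Fin d → ℝ) _)
  | Sum.inr j => (-2 : ℝ) • (ContinuousLinearMap.proj j ∘L
      ContinuousLinearMap.fst ℝ (Fin d → ℝ) ((Fin d → ℝ) × ℝ))

theorem verticalCoeff_es (k : Fin d ⊕ Fin d) : verticalCoeff d k (es d) = 0 := by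
  cases k <;> simp [verticalCoeff, es]

theorem Pop_apply (k : Fin d ⊕ Fin d) (f : HPt d → ℝ) (x : HPt d) :
    Pop d k f x = fderiv ℝ f x (horizontalDir d k + verticalCoeff d k x • es d) := by
  cases k
  · simp [Pop, Xop, horizontalDir, verticalCoeff]
  · simp [Pop, Xiop, horizontalDir, verticalCoeff, sub_eq_add_neg]

/-- The horizontal field `P_k` as a continuous operator on Schwartz functions. -/
noncomputable def popCLM (d : ℕ) (k : Fin d ⊕ Fin d) : 𝓢(HPt d, ℝ) →L[ℝ] 𝓢(HPt d, ℝ) :=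
  lineDerivOpCLM ℝ 𝓢(HPt d, ℝ) (horizontalDir d k) +
    SchwartzMap.smulLeftCLM ℝ (verticalCoeff d k) ∘L lineDerivOpCLM ℝ 𝓢(HPt d, ℝ) (es d)

theorem popCLM_eq (k : Fin d ⊕ Fin d) (f : 𝓢(HPt d, ℝ)) :
    popCLM d k f = ∂_{horizontalDir d k} f +
      SchwartzMap.smulLeftCLM ℝ (verticalCoeff d k) (∂_{es d} f) := rfl

theorem coe_popCLM (k : Fin d ⊕ Fin d) (f : 𝓢(HPt d, ℝ)) : ⇑(popCLM d k f) = Pop d k f := by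
  ext x
  have h : (⇑(verticalCoeff d k)).HasTemperateGrowth := by fun_prop
  simp [popCLM_eq, Pop_apply, h, SchwartzMap.lineDerivOp_apply_eq_fderiv]

theorem Pop_mul (k : Fin d ⊕ Fin d) (f g : 𝓢(HPt d, ℝ)) (x : HPt d) :
    Pop d k (f.mulPair g) x = f x * Pop d k g x + g x * Pop d k f x := by
  have h : fderiv ℝ (f.mulPair g) x = f x • fderiv ℝ g x + g x • fderiv ℝ f x :=
    ((f.hasFDerivAt x).mul (g.hasFDerivAt x)).fderiv
  simp only [Pop_apply, h, add_apply, smul_apply,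
    smul_eq_mul]

/-- Since `P_k` is divergence free, it integrates to zero against Schwartz functions. -/
theorem integral_Pop (k : Fin d ⊕ Fin d) (f : 𝓢(HPt d, ℝ)) : ∫ x, Pop d k f x = 0 := by
  have h : (⇑(verticalCoeff d k)).HasTemperateGrowth := by fun_prop
  have hs : SchwartzMap.smulLeftCLM ℝ (verticalCoeff d k) (∂_{es d} f) =
      ∂_{es d} (SchwartzMap.smulLeftCLM ℝ (verticalCoeff d k) f) := by
    ext x
    have hf : fderiv ℝ (fun y => verticalCoeff d k y * f y) x =
        verticalCoeff d k x • fderiv ℝ f x + f x • verticalCoeff d k :=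
      ((verticalCoeff d k).hasFDerivAt.mul (f.hasFDerivAt x)).fderiv
    rw [SchwartzMap.lineDerivOp_apply_eq_fderiv, SchwartzMap.smulLeftCLM_apply h f]
    simp [h, hf, verticalCoeff_es, SchwartzMap.lineDerivOp_apply_eq_fderiv]
  have hP : ∀ x, Pop d k f x = ∂_{horizontalDir d k} f x +
      ∂_{es d} (SchwartzMap.smulLeftCLM ℝ (verticalCoeff d k) f) x := by
    intro x
    rw [← coe_popCLM, popCLM_eq, hs, add_apply]
  simp_rw [hP]
  rw [integral_add (SchwartzMap.integrable _) (SchwartzMap.integrable _),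
    SchwartzMap.integral_lineDerivOp, SchwartzMap.integral_lineDerivOp, add_zero]

/-- The Navier–Stokes right-hand side `Δ_ℍ v − v·∇_ℍ v − ∇_ℍ q`, as Schwartz functions. -/
noncomputable def nsField (v : Fin d ⊕ Fin d → 𝓢(HPt d, ℝ)) (q : 𝓢(HPt d, ℝ))
    (i : Fin d ⊕ Fin d) : 𝓢(HPt d, ℝ) :=
  (∑ k, popCLM d k (popCLM d k (v i))) - (∑ j, (v j).mulPair (popCLM d j (v i))) - popCLM d i q

theorem nsField_apply (v : Fin d ⊕ Fin d → 𝓢(HPt d, ℝ)) (q : 𝓢(HPt d, ℝ))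
    (i : Fin d ⊕ Fin d) (x : HPt d) :
    nsField v q i x = (∑ k, Pop d k (Pop d k (v i)) x) - (∑ j, v j x * Pop d j (v i) x)
      - Pop d i q x := by
  simp [nsField, SchwartzMap.mulPair_apply, coe_popCLM]

/-- For a divergence-free field, the energy production is, up to terms `P_k h` with `h` Schwartz,
the negative of the horizontal gradient squared. -/
theorem sum_mul_nsField (v : Fin d ⊕ Fin d → 𝓢(HPt d, ℝ)) (q : 𝓢(HPt d, ℝ)) (x : HPt d)
    (hdiv : ∑ i, Pop d i (v i) x = 0) :
    ∑ i, v i x * nsField v q i x =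
      (∑ i, ∑ k, Pop d k ((v i).mulPair (popCLM d k (v i))) x)
      - (1 / 2) * (∑ i, ∑ j, Pop d j ((v j).mulPair ((v i).mulPair (v i))) x)
      - (∑ i, Pop d i ((v i).mulPair q) x)
      - ∑ i, ∑ k, (Pop d k (v i) x) ^ 2 := by
  have hq : ∑ i, Pop d i ((v i).mulPair q) x = ∑ i, v i x * Pop d i q x := by
    simp only [Pop_mul, Finset.sum_add_distrib, ← Finset.mul_sum, hdiv, mul_zero, add_zero]
  have hc : ∀ i, ∑ j, Pop d j ((v j).mulPair ((v i).mulPair (v i))) x =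
      2 * ∑ j, v i x * (v j x * Pop d j (v i) x) := by
    intro i
    simp only [Pop_mul, Finset.sum_add_distrib, ← Finset.mul_sum, hdiv, mul_zero, add_zero]
    simp only [Finset.mul_sum]
    refine Finset.sum_congr rfl fun j _ => ?_
    ring
  have hl : ∀ i k, Pop d k ((v i).mulPair (popCLM d k (v i))) x =
      v i x * Pop d k (Pop d k (v i)) x + (Pop d k (v i) x) ^ 2 := by
    intro i k
    rw [Pop_mul, coe_popCLM, sq]
  simp only [hq, hc, hl, nsField_apply, mul_sub, Finset.mul_sum, Finset.sum_sub_distrib,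
    Finset.sum_add_distrib]
  ring_nf

theorem integrable_Pop (k : Fin d ⊕ Fin d) (f : 𝓢(HPt d, ℝ)) : Integrable (Pop d k f) := by
  rw [← coe_popCLM]
  exact SchwartzMap.integrable _

theorem integral_sum_mul_nsField (v : Fin d ⊕ Fin d → 𝓢(HPt d, ℝ)) (q : 𝓢(HPt d, ℝ))
    (hdiv : ∀ x, ∑ i, Pop d i (v i) x = 0) :
    ∫ x, ∑ i, v i x * nsField v q i x = -(∑ i, ∑ k, ∫ x, (Pop d k (v i) x) ^ 2) := by
  have hsq : ∀ i k, Integrable fun x => (Pop d k (v i) x) ^ 2 := fun i k => by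
    have h := ((popCLM d k (v i)).mulPair (popCLM d k (v i))).integrable (μ := volume)
    refine h.congr (.of_forall fun x => ?_)
    simp only [SchwartzMap.mulPair_apply, coe_popCLM, sq]
  have hP := fun k f => integrable_Pop (d := d) k f
  rw [integral_congr_ae (.of_forall fun x => sum_mul_nsField v q x (hdiv x))]
  have h1 : Integrable fun x => ∑ i, ∑ k, Pop d k ((v i).mulPair (popCLM d k (v i))) x :=
    integrable_finsetSum _ fun i _ => integrable_finsetSum _ fun k _ => hP _ _
  have h2 : Integrable fun x =>
      (1 / 2 : ℝ) * ∑ i, ∑ j, Pop d j ((v j).mulPair ((v i).mulPair (v i))) x :=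
    (integrable_finsetSum _ fun i _ => integrable_finsetSum _ fun k _ => hP _ _).const_mul _
  have h3 : Integrable fun x => ∑ i, Pop d i ((v i).mulPair q) x :=
    integrable_finsetSum _ fun i _ => hP _ _
  have h4 : Integrable fun x => ∑ i, ∑ k, (Pop d k (v i) x) ^ 2 :=
    integrable_finsetSum _ fun i _ => integrable_finsetSum _ fun k _ => hsq i k
  rw [integral_sub (by exact (h1.sub h2).sub h3) h4, integral_sub (by exact h1.sub h2) h3,
    integral_sub h1 h2, integral_const_mul]
  have hsum2 : ∀ G : Fin d ⊕ Fin d → Fin d ⊕ Fin d → HPt d → ℝ, (∀ i k, Integrable (G i k)) →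
      ∫ x, ∑ i, ∑ k, G i k x = ∑ i, ∑ k, ∫ x, G i k x := by
    intro G hG
    rw [integral_finsetSum _ fun i _ => integrable_finsetSum _ fun k _ => hG i k]
    exact Finset.sum_congr rfl fun i _ => integral_finsetSum _ fun k _ => hG i k
  rw [hsum2 _ fun i k => hP _ _, hsum2 _ fun i k => hP _ _, hsum2 _ hsq,
    integral_finsetSum _ fun i _ => hP _ _]
  simp [integral_Pop]

theorem exists_forall_abs_nsField_le {u : ℝ → Fin d ⊕ Fin d → 𝓢(HPt d, ℝ)}
    {q : ℝ → 𝓢(HPt d, ℝ)} (hu : ∀ i, Continuous fun t => u t i) (hq : Continuous q)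
    {K : Set ℝ} (hK : IsCompact K) (i : Fin d ⊕ Fin d) :
    ∃ C, ∀ t ∈ K, ∀ x, |nsField (u t) (q t) i x| ≤ C := by
  choose A hA0 hA using fun k => SchwartzMap.exists_forall_abs_le
    ((popCLM d k).continuous.comp ((popCLM d k).continuous.comp (hu i))) hK
  choose B hB0 hB using fun j => SchwartzMap.exists_forall_abs_le (hu j) hK
  choose B' hB0' hB' using fun j => SchwartzMap.exists_forall_abs_le
    ((popCLM d j).continuous.comp (hu i)) hK
  obtain ⟨Q, -, hQ⟩ := SchwartzMap.exists_forall_abs_le ((popCLM d i).continuous.comp hq) hK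
  simp only [Function.comp_apply, coe_popCLM] at hA hB' hQ
  refine ⟨(∑ k, A k) + (∑ j, B j * B' j) + Q, fun t ht x => ?_⟩
  rw [nsField_apply]
  refine (abs_sub _ _).trans (add_le_add ((abs_sub _ _).trans (add_le_add ?_ ?_)) (hQ t ht x))
  · exact (Finset.abs_sum_le_sum_abs _ _).trans (Finset.sum_le_sum fun k _ => hA k t ht x)
  · refine (Finset.abs_sum_le_sum_abs _ _).trans (Finset.sum_le_sum fun j _ => ?_)
    rw [abs_mul]
    exact mul_le_mul (hB j t ht x) (hB' j t ht x) (abs_nonneg _) (hB0 j)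

end Horizontal

/-- Energy dissipation law for the sub-Riemannian Navier–Stokes system on `ℍ^d`.
Let `u(t,·)` (horizontal, Schwartz in space, depending smoothly on `(t,x)` and continuously
on `t` in the Schwartz topology — "locally uniformly in t") and `p(t,·)` solve
`∂_t u − Δ_ℍ u + u·∇_ℍ u = −∇_ℍ p`, `div_ℍ u = 0`.  Then for every `t > 0`,
`(1/2) (d/dt) ‖u(t)‖²_{L²} + ‖∇_ℍ u(t)‖²_{L²} = 0`. -/
theorem heisenberg_NS_energy_dissipation (d : ℕ) (hd : 1 ≤ d)
    (u : ℝ → (Fin d ⊕ Fin d) → SchwartzMap (HPt d) ℝ)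
    (pr : ℝ → SchwartzMap (HPt d) ℝ)
    (hu_smooth : ∀ i, ContDiff ℝ (⊤ : ℕ∞) fun q : ℝ × HPt d => u q.1 i q.2)
    (hpr_smooth : ContDiff ℝ (⊤ : ℕ∞) fun q : ℝ × HPt d => pr q.1 q.2)
    (hu_cont : ∀ i, Continuous fun t => u t i)
    (hpr_cont : Continuous pr)
    (heq : ∀ t : ℝ, 0 < t → ∀ (x : HPt d) (i : Fin d ⊕ Fin d),
      deriv (fun τ => u τ i x) t - (∑ k, Pop d k (Pop d k (⇑(u t i))) x)
        + (∑ j, u t j x * Pop d j (⇑(u t i)) x) = -(Pop d i (⇑(pr t)) x))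
    (hdiv : ∀ t : ℝ, 0 < t → ∀ x : HPt d, ∑ i, Pop d i (⇑(u t i)) x = 0) :
    ∀ t : ℝ, 0 < t →
      HasDerivAt (fun τ => (1 / 2 : ℝ) * ∫ x, ∑ i, (u τ i x) ^ 2)
        (-(∑ i, ∑ j, ∫ x, (Pop d j (⇑(u t i)) x) ^ 2)) t := by
  intro t ht
  have hderiv : ∀ τ, 0 < τ → ∀ i x,
      HasDerivAt (fun r => u r i x) (nsField (u τ) (pr τ) i x) τ := by
    intro τ hτ i x
    have hd : DifferentiableAt ℝ (fun r => u r i x) τ :=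
      (((hu_smooth i).differentiable (by simp)).comp
        (differentiable_id.prodMk (differentiable_const x))) τ
    have he : nsField (u τ) (pr τ) i x = deriv (fun r => u r i x) τ := by
      rw [nsField_apply]
      linarith [heq τ hτ x i]
    rw [he]
    exact hd.hasDerivAt
  have hK : Set.Icc (t / 2) (2 * t) ∈ 𝓝 t := Icc_mem_nhds (by linarith) (by linarith)
  have h := SchwartzMap.hasDerivAt_integral_sum_sq volume (w := fun τ => nsField (u τ) (pr τ))
    hu_cont isCompact_Icc hK
    (exists_forall_abs_nsField_le hu_cont hpr_cont isCompact_Icc)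
    (fun τ hτ => hderiv τ (by linarith [hτ.1]))
  convert! h.const_mul (1 / 2 : ℝ) using 1
  simp_rw [← Finset.mul_sum]
  rw [integral_const_mul, integral_sum_mul_nsField (u t) (pr t) (hdiv t ht)]
  ring
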